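/- arXiv:1905.06758 — 8 statements merged into one kernel-verified Lean document; each statement's English description precedes it below -/
import Mathlib

section
/- For A ∈ Matrix (Fin 2) (Fin 2) ℂ, identify A with the vector (A₀₀, A₀₁, A₁₀, A₁₁) ∈ ℂ⁴ and let ∇det(A) = (A₁₁, −A₁₀, −A₀₁, A₀₀) be the gradient of the determinant. Then the set { A ∈ Matrix (Fin 2) (Fin 2) ℂ : det A = 0, A₀₀² + A₀₁² + A₁₀² + A₁₁² = 0, and the vectors ∇det(A) and (A₀₀, A₀₁, A₁₀, A₁₁) are ℂ-linearly dependent in ℂ⁴ } equals the union of the four one-dimensional ℂ-linear subspaces ℂ·M_{ε,δ}, where for ε, δ ∈ {1, −1} the matrix M_{ε,δ} has entries M₀₀ = −εδ, M₀₁ = ε·i, M₁₀ = δ·i, M₁₁ = 1, with i the imaginary unit. -/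
open Complex

/-- If the gradient of the determinant at `A` is linearly dependent on the entry vector of `A`,
then it equals the entry vector up to sign. -/
theorem eq_or_eq_neg_of_gradient_dependent {A : Matrix (Fin 2) (Fin 2) ℂ}
    (h : ¬ LinearIndependent ℂ
      ![![A 1 1, -(A 1 0), -(A 0 1), A 0 0], ![A 0 0, A 0 1, A 1 0, A 1 1]]) :
    (A 1 1 = A 0 0 ∧ A 1 0 = -A 0 1) ∨ (A 1 1 = -A 0 0 ∧ A 1 0 = A 0 1) := by
  simp only [LinearIndependent.pair_iff, not_forall] at h
  obtain ⟨s, t, hst, hne⟩ := h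
  have h₀ : s * A 1 1 + t * A 0 0 = 0 := by simpa using congrFun hst 0
  have h₁ : s * -A 1 0 + t * A 0 1 = 0 := by simpa using congrFun hst 1
  have h₂ : s * -A 0 1 + t * A 1 0 = 0 := by simpa using congrFun hst 2
  have h₃ : s * A 0 0 + t * A 1 1 = 0 := by simpa using congrFun hst 3
  by_cases hs : s + t = 0
  · left
    have ht : t = -s := by linear_combination hs
    subst ht
    have hs₀ : s ≠ 0 := fun h => hne (by simp [h])
    constructor <;> apply mul_left_cancel₀ hs₀
    · linear_combination h₀
    · linear_combination -h₁
  · right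
    constructor <;> apply mul_left_cancel₀ hs
    · linear_combination h₀ + h₃
    · linear_combination h₂ - h₁

/-- The locus of non-transversal intersection of the variety of singular `2 × 2`
complex matrices with the isotropic quadric: the set of matrices `A` with
`det A = 0`, isotropic entry vector, and with the gradient of the determinant
linearly dependent on the entry vector of `A`, is the union of the four lines
`ℂ • M_{ε,δ}` with `M_{ε,δ} = !![-εδ, ε i; δ i, 1]` for `ε, δ ∈ {1, -1}`. -/
theorem stmt_3 :
    {A : Matrix (Fin 2) (Fin 2) ℂ |
        A.det = 0 ∧ (A 0 0) ^ 2 + (A 0 1) ^ 2 + (A 1 0) ^ 2 + (A 1 1) ^ 2 = 0 ∧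
        ¬ LinearIndependent ℂ
            ![![A 1 1, -(A 1 0), -(A 0 1), A 0 0], ![A 0 0, A 0 1, A 1 0, A 1 1]]} =
      ⋃ ε ∈ ({1, -1} : Set ℂ), ⋃ δ ∈ ({1, -1} : Set ℂ),
        {A : Matrix (Fin 2) (Fin 2) ℂ |
          ∃ c : ℂ, A = c • !![-(ε * δ), ε * I; δ * I, 1]} := by
  ext A
  simp only [Set.mem_ofPred_eq, Set.mem_iUnion, Set.mem_insert_iff, Set.mem_singleton_iff,
    exists_prop, Matrix.det_fin_two]
  constructor
  · rintro ⟨hdet, -, hdep⟩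
    rcases eq_or_eq_neg_of_gradient_dependent hdep with ⟨h₁, h₂⟩ | ⟨h₁, h₂⟩
    · have hfac : (A 0 1 - A 0 0 * I) * (A 0 1 + A 0 0 * I) = 0 := by
        rw [h₁, h₂] at hdet
        linear_combination hdet - (A 0 0) ^ 2 * I_sq
      rcases mul_eq_zero.mp hfac with h | h
      · refine ⟨1, Or.inl rfl, -1, Or.inr rfl, A 0 0, ?_⟩
        ext i j
        fin_cases i <;> fin_cases j <;> simp <;> grind
      · refine ⟨-1, Or.inr rfl, 1, Or.inl rfl, A 0 0, ?_⟩
        ext i j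
        fin_cases i <;> fin_cases j <;> simp <;> grind
    · have hfac : (A 0 1 - A 0 0 * I) * (A 0 1 + A 0 0 * I) = 0 := by
        rw [h₁, h₂] at hdet
        linear_combination -hdet - (A 0 0) ^ 2 * I_sq
      rcases mul_eq_zero.mp hfac with h | h
      · refine ⟨-1, Or.inr rfl, -1, Or.inr rfl, -A 0 0, ?_⟩
        ext i j
        fin_cases i <;> fin_cases j <;> simp <;> grind
      · refine ⟨1, Or.inl rfl, 1, Or.inl rfl, -A 0 0, ?_⟩
        ext i j
        fin_cases i <;> fin_cases j <;> simp <;> grind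
  · rintro ⟨ε, hε, δ, hδ, c, rfl⟩
    have hε' : ε ^ 2 = 1 := by rcases hε with rfl | rfl <;> norm_num
    have hδ' : δ ^ 2 = 1 := by rcases hδ with rfl | rfl <;> norm_num
    have hI := I_sq
    simp only [Matrix.smul_apply, Matrix.of_apply, Matrix.cons_val', Matrix.cons_val_zero,
      Matrix.cons_val_one, Matrix.cons_val_fin_one, smul_eq_mul, LinearIndependent.pair_iff]
    refine ⟨by grind, by grind, fun h => ?_⟩
    refine one_ne_zero (h 1 (ε * δ) ?_).1
    ext i
    fin_cases i <;> simp <;> grind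
end

section
/- There exists a nonzero polynomial g in four complex variables such that for every u = (u₀, u₁, u₂, u₃) ∈ ℂ⁴ with g(u) ≠ 0, the set { x ∈ ℂ⁴ : x ≠ 0, x₀x₃ − x₁x₂ = 0, and there exists λ ∈ ℂ with x − u = λ·(x₃, −x₂, −x₁, x₀) } has exactly 2 elements. -/
/-- The critical point on the cone for the data `u`, where `p ^ 2 = (u₀ + u₃)² + (u₁ - u₂)²` and
`q ^ 2 = (u₀ - u₃)² + (u₁ + u₂)²`. -/
noncomputable def quadricCriticalPoint (u : Fin 4 → ℂ) (p q : ℂ) : Fin 4 → ℂ :=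
  ![((u 0 + u 3) * ((p + q) / (2 * p)) + (u 0 - u 3) * ((p + q) / (2 * q))) / 2,
    ((u 1 + u 2) * ((p + q) / (2 * q)) + (u 1 - u 2) * ((p + q) / (2 * p))) / 2,
    ((u 1 + u 2) * ((p + q) / (2 * q)) - (u 1 - u 2) * ((p + q) / (2 * p))) / 2,
    ((u 0 + u 3) * ((p + q) / (2 * p)) - (u 0 - u 3) * ((p + q) / (2 * q))) / 2]

lemma quadricCriticalPoint_mem {u : Fin 4 → ℂ} {p q : ℂ}
    (hP : p ^ 2 = (u 0 + u 3) ^ 2 + (u 1 - u 2) ^ 2)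
    (hQ : q ^ 2 = (u 0 - u 3) ^ 2 + (u 1 + u 2) ^ 2)
    (hp : p ≠ 0) (hq : q ≠ 0) (hpq : p + q ≠ 0) :
    quadricCriticalPoint u p q ∈ {x : Fin 4 → ℂ | x ≠ 0 ∧ x 0 * x 3 - x 1 * x 2 = 0 ∧
      ∃ l : ℂ, x - u = l • ![x 3, -(x 2), -(x 1), x 0]} := by
  refine ⟨fun h => ?_, ?_, (q - p) / (p + q), ?_⟩
  · have h0 := congrFun h 0
    have h1 := congrFun h 1
    have h2 := congrFun h 2
    have h3 := congrFun h 3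
    simp only [quadricCriticalPoint, Matrix.cons_val, Pi.zero_apply] at h0 h1 h2 h3
    have ht : (p + q) / (2 * p) ≠ 0 :=
      div_ne_zero hpq (mul_ne_zero two_ne_zero hp)
    have ha : u 0 + u 3 = 0 :=
      (mul_eq_zero.mp (by linear_combination h0 + h3)).resolve_right ht
    have hc : u 1 - u 2 = 0 :=
      (mul_eq_zero.mp (by linear_combination h1 - h2)).resolve_right ht
    rw [ha, hc] at hP
    simp_all
  · simp only [quadricCriticalPoint, Matrix.cons_val]
    field_simp
    linear_combination (p + q) ^ 2 * (p ^ 2 * hQ - q ^ 2 * hP)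
  · ext i
    fin_cases i <;> simp [quadricCriticalPoint] <;> field_simp <;> ring

lemma quadricCriticalPoint_ne_neg {u : Fin 4 → ℂ} {p q : ℂ}
    (hP : p ^ 2 = (u 0 + u 3) ^ 2 + (u 1 - u 2) ^ 2) (hp : p ≠ 0) (hq : q ≠ 0) :
    quadricCriticalPoint u p q ≠ quadricCriticalPoint u p (-q) := by
  intro h
  have h0 := congrFun h 0
  have h1 := congrFun h 1
  have h2 := congrFun h 2
  have h3 := congrFun h 3
  simp only [quadricCriticalPoint, Matrix.cons_val] at h0 h1 h2 h3
  have ht : (p + q) / (2 * p) - (p + -q) / (2 * p) ≠ 0 := by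
    rw [show (p + q) / (2 * p) - (p + -q) / (2 * p) = q / p by field_simp; ring]
    exact div_ne_zero hq hp
  have ha : u 0 + u 3 = 0 :=
    (mul_eq_zero.mp (by linear_combination h0 + h3)).resolve_right ht
  have hc : u 1 - u 2 = 0 :=
    (mul_eq_zero.mp (by linear_combination h1 - h2)).resolve_right ht
  rw [ha, hc] at hP
  simp_all

lemma eq_quadricCriticalPoint {u x : Fin 4 → ℂ} {p q l : ℂ} (hp : p ≠ 0) (hq : q ≠ 0)
    (hx : x - u = l • ![x 3, -(x 2), -(x 1), x 0]) (hl : p * (1 + l) = q * (1 - l)) :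
    x = quadricCriticalPoint u p q := by
  have h0 := congrFun hx 0
  have h1 := congrFun hx 1
  have h2 := congrFun hx 2
  have h3 := congrFun hx 3
  simp only [Pi.sub_apply, Pi.smul_apply, Matrix.cons_val, smul_eq_mul] at h0 h1 h2 h3
  have ha : x 0 + x 3 = (u 0 + u 3) * ((p + q) / (2 * p)) := by
    field_simp
    linear_combination (p + q) * (h0 + h3) + (x 0 + x 3) * hl
  have hb : x 0 - x 3 = (u 0 - u 3) * ((p + q) / (2 * q)) := by
    field_simp
    linear_combination (p + q) * (h0 - h3) - (x 0 - x 3) * hl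
  have hc : x 1 - x 2 = (u 1 - u 2) * ((p + q) / (2 * p)) := by
    field_simp
    linear_combination (p + q) * (h1 - h2) + (x 1 - x 2) * hl
  have hd : x 1 + x 2 = (u 1 + u 2) * ((p + q) / (2 * q)) := by
    field_simp
    linear_combination (p + q) * (h1 + h2) - (x 1 + x 2) * hl
  ext i
  fin_cases i <;> simp only [quadricCriticalPoint, Fin.zero_eta, Fin.mk_one, Fin.reduceFinMk,
    Matrix.cons_val, ← ha, ← hb, ← hc, ← hd] <;> ring

/-- The unit Euclidean distance degree of the quadric `x₀x₃ - x₁x₂ = 0` is `2`: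
there is a nonzero polynomial `g` in the data `u` such that whenever `g(u) ≠ 0`,
the function `∑ᵢ (xᵢ - uᵢ)²` has exactly `2` critical points on the smooth locus
of the affine cone, i.e. there are exactly `2` nonzero points `x` of the cone at
which `x - u` is a scalar multiple of the gradient `(x₃, -x₂, -x₁, x₀)`. -/
theorem stmt_4 :
    ∃ g : MvPolynomial (Fin 4) ℂ, g ≠ 0 ∧
      ∀ u : Fin 4 → ℂ, MvPolynomial.eval u g ≠ 0 →
        Set.ncard {x : Fin 4 → ℂ | x ≠ 0 ∧ x 0 * x 3 - x 1 * x 2 = 0 ∧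
          ∃ l : ℂ, x - u = l • ![x 3, -(x 2), -(x 1), x 0]} = 2 := by
  let P : MvPolynomial (Fin 4) ℂ :=
    (.X 0 + .X 3) ^ 2 + (.X 1 - .X 2) ^ 2
  let Q : MvPolynomial (Fin 4) ℂ :=
    (.X 0 - .X 3) ^ 2 + (.X 1 + .X 2) ^ 2
  refine ⟨P * Q * (P - Q), fun h => ?_, fun u hu => ?_⟩
  · have h' := congrArg (MvPolynomial.eval ![2, 0, 0, 1]) h
    simp [P, Q] at h'
    norm_num at h'
  · obtain ⟨p, hP⟩ := IsAlgClosed.exists_pow_nat_eq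
      ((u 0 + u 3) ^ 2 + (u 1 - u 2) ^ 2) (n := 2) two_pos
    obtain ⟨q, hQ⟩ := IsAlgClosed.exists_pow_nat_eq
      ((u 0 - u 3) ^ 2 + (u 1 + u 2) ^ 2) (n := 2) two_pos
    simp only [P, Q, map_mul, map_sub, map_add, map_pow, MvPolynomial.eval_X, ← hP, ← hQ] at hu
    have hp : p ≠ 0 := by rintro rfl; simp at hu
    have hq : q ≠ 0 := by rintro rfl; simp at hu
    have hpq : p + q ≠ 0 := fun h => hu (by linear_combination p ^ 2 * q ^ 2 * (p - q) * h)
    have hpq' : p + -q ≠ 0 := fun h => hu (by linear_combination p ^ 2 * q ^ 2 * (p + q) * h)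
    rw [Set.ncard_eq_two]
    refine ⟨_, _, quadricCriticalPoint_ne_neg hP hp hq, Set.Subset.antisymm ?_ ?_⟩
    · rintro x ⟨-, hf, l, hx⟩
      have h0 := congrFun hx 0
      have h1 := congrFun hx 1
      have h2 := congrFun hx 2
      have h3 := congrFun hx 3
      simp only [Pi.sub_apply, Pi.smul_apply, Matrix.cons_val, smul_eq_mul] at h0 h1 h2 h3
      have e0 : u 0 = x 0 - l * x 3 := by linear_combination -h0
      have e1 : u 1 = x 1 + l * x 2 := by linear_combination -h1
      have e2 : u 2 = x 2 + l * x 1 := by linear_combination -h2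
      have e3 : u 3 = x 3 - l * x 0 := by linear_combination -h3
      rw [e0, e1, e2, e3] at hP hQ
      have hsq : (p * (1 + l)) ^ 2 = (q * (1 - l)) ^ 2 := by
        linear_combination (1 + l) ^ 2 * hP - (1 - l) ^ 2 * hQ
          + 4 * (1 + l) ^ 2 * (1 - l) ^ 2 * hf
      rcases sq_eq_sq_iff_eq_or_eq_neg.mp hsq with h | h
      · exact Or.inl (eq_quadricCriticalPoint hp hq hx h)
      · exact Or.inr (eq_quadricCriticalPoint hp (neg_ne_zero.mpr hq) hx (by rw [h]; ring))
    · rintro x (rfl | rfl)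
      · exact quadricCriticalPoint_mem hP hQ hp hq hpq
      · exact quadricCriticalPoint_mem hP (by rw [neg_sq, hQ]) hp (neg_ne_zero.mpr hq) hpq'
end

section
/- There exists a nonzero polynomial G in eight complex variables such that for every pair (w, u) ∈ ℂ⁴ × ℂ⁴, w = (w₀, w₁, w₂, w₃), u = (u₀, u₁, u₂, u₃), with G(w, u) ≠ 0, the set { x ∈ ℂ⁴ : x ≠ 0, x₀x₃ − x₁x₂ = 0, and there exists λ ∈ ℂ with (w₀(x₀ − u₀), w₁(x₁ − u₁), w₂(x₂ − u₂), w₃(x₃ − u₃)) = λ·(x₃, −x₂, −x₁, x₀) } has exactly 6 elements. -/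
open Polynomial in
/-- The polynomial in the multiplier `l` obtained by solving the linear equations
`wᵢ(xᵢ - uᵢ) = l • ∂ᵢ(x₀x₃ - x₁x₂)` for `x`, substituting in the quadric and clearing
denominators. -/
noncomputable def multiplierPoly {R : Type*} [CommRing R] (w u : Fin 4 → R) : R[X] :=
  (C (w 0 * w 3 * u 0) + C (w 3 * u 3) * X) * (C (w 0 * w 3 * u 3) + C (w 0 * u 0) * X) *
      (C (w 1 * w 2) - X ^ 2) ^ 2 -
    (C (w 1 * w 2 * u 1) - C (w 2 * u 2) * X) * (C (w 1 * w 2 * u 2) - C (w 1 * u 1) * X) *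
      (C (w 0 * w 3) - X ^ 2) ^ 2

/-- The coefficient of degree `6` of `multiplierPoly w u`. -/
def multiplierLead {R : Type*} [CommRing R] (w u : Fin 4 → R) : R :=
  w 3 * u 3 * (w 0 * u 0) - w 2 * u 2 * (w 1 * u 1)

/-- A polynomial expression in the weights and data whose nonvanishing ensures that
`multiplierPoly w u` has six simple roots, each of them giving a critical point. -/
noncomputable def genericityExpr {R : Type*} [CommRing R] (w u : Fin 4 → R) : R :=
  w 0 * w 1 * w 2 * w 3 * (w 0 * w 3 - w 1 * w 2) *
    (w 0 * u 0 ^ 2 - w 3 * u 3 ^ 2) * (w 1 * u 1 ^ 2 - w 2 * u 2 ^ 2) * multiplierLead w u *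
    (multiplierPoly w u).resultant (multiplierPoly w u).derivative 6 5

section CommRing

variable {R S : Type*} [CommRing R] [CommRing S]

lemma multiplierPoly_map (φ : R →+* S) (w u : Fin 4 → R) :
    (multiplierPoly w u).map φ = multiplierPoly (φ ∘ w) (φ ∘ u) := by
  simp [multiplierPoly]

lemma map_genericityExpr (φ : R →+* S) (w u : Fin 4 → R) :
    φ (genericityExpr w u) = genericityExpr (φ ∘ w) (φ ∘ u) := by
  simp only [genericityExpr, map_mul]
  rw [← Polynomial.resultant_map_map, ← Polynomial.derivative_map, multiplierPoly_map]
  simp [multiplierLead]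

open Polynomial in
lemma multiplierPoly_natDegree (w u : Fin 4 → R) (h : multiplierLead w u ≠ 0) :
    (multiplierPoly w u).natDegree = 6 := by
  unfold multiplierPoly
  unfold multiplierLead at h
  compute_degree!

open Polynomial in
lemma derivative_multiplierPoly_natDegree {K : Type*} [Field K] [CharZero K] (w u : Fin 4 → K)
    (h : multiplierLead w u ≠ 0) : (multiplierPoly w u).derivative.natDegree = 5 := by
  rw [natDegree_derivative, multiplierPoly_natDegree w u h]

end CommRing

open Polynomial in
lemma genericityExpr_witness : genericityExpr (![1, 4, -1, -1] : Fin 4 → ℂ) ![1, 1, 2, 1] ≠ 0 := by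
  have hl : multiplierLead (![1, 4, -1, -1] : Fin 4 → ℂ) ![1, 1, 2, 1] = 7 := by
    simp [multiplierLead]; norm_num
  have hl' : multiplierLead (![1, 4, -1, -1] : Fin 4 → ℂ) ![1, 1, 2, 1] ≠ 0 := by
    rw [hl]; norm_num
  have hP : multiplierPoly (![1, 4, -1, -1] : Fin 4 → ℂ) ![1, 1, 2, 1] =
      7 * X ^ 6 - 23 * X ^ 4 - 64 * X ^ 2 - 16 := by
    simp [multiplierPoly]
    have h4 : (C 4 : ℂ[X]) = 4 := rfl
    have h2 : (C 2 : ℂ[X]) = 2 := rfl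
    rw [h4, h2]
    ring
  have hres : (multiplierPoly (![1, 4, -1, -1] : Fin 4 → ℂ) ![1, 1, 2, 1]).resultant
      (multiplierPoly ![1, 4, -1, -1] ![1, 1, 2, 1]).derivative 6 5 ≠ 0 := by
    have := resultant_ne_zero (multiplierPoly (![1, 4, -1, -1] : Fin 4 → ℂ) ![1, 1, 2, 1])
      (multiplierPoly ![1, 4, -1, -1] ![1, 1, 2, 1]).derivative ?_
    · rwa [multiplierPoly_natDegree _ _ hl', derivative_multiplierPoly_natDegree _ _ hl'] at this
    rw [hP]
    refine ⟨C (-1/16) + C (-60439/677736) * X ^ 2 + C (61607/1807296) * X ^ 4,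
      C (1/2) * X * (C (229873/2710944) + C (25405/602432) * X ^ 2 +
        C (-61607/5421888) * X ^ 4), ?_⟩
    apply Polynomial.funext
    intro r
    simp
    ring
  unfold genericityExpr
  rw [hl]
  refine mul_ne_zero ?_ hres
  simp; norm_num

/-- The solution `x` of the linear equations `wᵢ(xᵢ - uᵢ) = l • ∂ᵢ(x₀x₃ - x₁x₂)`. -/
noncomputable def criticalPoint {K : Type*} [Field K] (w u : Fin 4 → K) (l : K) : Fin 4 → K :=
  ![(w 0 * w 3 * u 0 + w 3 * u 3 * l) / (w 0 * w 3 - l ^ 2),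
    (w 1 * w 2 * u 1 - w 2 * u 2 * l) / (w 1 * w 2 - l ^ 2),
    (w 1 * w 2 * u 2 - w 1 * u 1 * l) / (w 1 * w 2 - l ^ 2),
    (w 0 * w 3 * u 3 + w 0 * u 0 * l) / (w 0 * w 3 - l ^ 2)]

section Field

variable {K : Type*} [Field K]

lemma pair_equations_iff {a b p q x y l : K} (h : a * b - l ^ 2 ≠ 0) :
    (a * (x - p) = l * y ∧ b * (y - q) = l * x) ↔
      x = (a * b * p + b * q * l) / (a * b - l ^ 2) ∧
        y = (a * b * q + a * p * l) / (a * b - l ^ 2) := by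
  rw [eq_div_iff h, eq_div_iff h]
  constructor
  · rintro ⟨h1, h2⟩
    exact ⟨by linear_combination b * h1 + l * h2, by linear_combination a * h2 + l * h1⟩
  · rintro ⟨h1, h2⟩
    exact ⟨mul_left_cancel₀ h (by linear_combination a * h1 - l * h2),
      mul_left_cancel₀ h (by linear_combination b * h2 - l * h1)⟩

lemma sub_sq_ne_zero_of_pair_equations {a b p q x y l : K} (ha : a ≠ 0) (hb : b ≠ 0)
    (h : a * p ^ 2 - b * q ^ 2 ≠ 0) (h1 : a * (x - p) = l * y) (h2 : b * (y - q) = l * x) :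
    a * b - l ^ 2 ≠ 0 := by
  intro h0
  have h3 : l * p + b * q = 0 :=
    mul_left_cancel₀ ha (by linear_combination -l * h1 - a * h2 + y * h0)
  have h4 : a * p + l * q = 0 :=
    mul_left_cancel₀ hb (by linear_combination -b * h1 - l * h2 + x * h0)
  exact h (by linear_combination p * h4 - q * h3)

lemma pair_numerator_ne_zero {a b p q l : K} (ha : a ≠ 0) (hb : b ≠ 0)
    (h : a * p ^ 2 - b * q ^ 2 ≠ 0) (h0 : a * b - l ^ 2 = 0) : a * b * p + b * q * l ≠ 0 := by
  intro h1
  have h2 : a * p + q * l = 0 := mul_left_cancel₀ hb (by linear_combination h1)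
  exact h (mul_left_cancel₀ ha
    (by linear_combination (a * p - q * l) * h2 - q ^ 2 * h0))

lemma pair_factors_ne_zero {a b p q l : K} (ha : a ≠ 0) (hb : b ≠ 0)
    (h : a * p ^ 2 - b * q ^ 2 ≠ 0) (h0 : a * b - l ^ 2 = 0) :
    (a * b * p + b * q * l) * (a * b * q + a * p * l) ≠ 0 := by
  refine mul_ne_zero (pair_numerator_ne_zero ha hb h h0) ?_
  rw [mul_comm a b] at h0 ⊢
  exact pair_numerator_ne_zero hb ha (by rwa [← neg_sub, neg_ne_zero]) h0

lemma eval_multiplierPoly (w u : Fin 4 → K) (l : K) :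
    (multiplierPoly w u).eval l =
      (w 0 * w 3 * u 0 + w 3 * u 3 * l) * (w 0 * w 3 * u 3 + w 0 * u 0 * l) *
        (w 1 * w 2 - l ^ 2) ^ 2 -
      (w 1 * w 2 * u 1 - w 2 * u 2 * l) * (w 1 * w 2 * u 2 - w 1 * u 1 * l) *
        (w 0 * w 3 - l ^ 2) ^ 2 := by
  simp [multiplierPoly]

lemma criticalPoint_mem_quadric_iff {w u : Fin 4 → K} {l : K} (hA : w 0 * w 3 - l ^ 2 ≠ 0)
    (hB : w 1 * w 2 - l ^ 2 ≠ 0) :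
    criticalPoint w u l 0 * criticalPoint w u l 3 -
      criticalPoint w u l 1 * criticalPoint w u l 2 = 0 ↔ (multiplierPoly w u).eval l = 0 := by
  have : (multiplierPoly w u).eval l =
      (criticalPoint w u l 0 * criticalPoint w u l 3 -
        criticalPoint w u l 1 * criticalPoint w u l 2) *
      ((w 0 * w 3 - l ^ 2) ^ 2 * (w 1 * w 2 - l ^ 2) ^ 2) := by
    rw [eval_multiplierPoly]
    simp only [criticalPoint, Matrix.cons_val]
    field_simp
  rw [this, mul_eq_zero, or_iff_left (by positivity)]

lemma gradient_equations_iff (w u x : Fin 4 → K) (l : K) :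
    (fun i => w i * (x i - u i)) = l • ![x 3, -(x 2), -(x 1), x 0] ↔
      (w 0 * (x 0 - u 0) = l * x 3 ∧ w 3 * (x 3 - u 3) = l * x 0) ∧
        (w 1 * (x 1 - u 1) = -l * x 2 ∧ w 2 * (x 2 - u 2) = -l * x 1) := by
  simp [funext_iff, Fin.forall_fin_succ]
  tauto

lemma gradient_equations_iff_eq_criticalPoint {w u x : Fin 4 → K} {l : K}
    (hA : w 0 * w 3 - l ^ 2 ≠ 0) (hB : w 1 * w 2 - l ^ 2 ≠ 0) :
    (fun i => w i * (x i - u i)) = l • ![x 3, -(x 2), -(x 1), x 0] ↔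
      x = criticalPoint w u l := by
  rw [gradient_equations_iff, pair_equations_iff hA,
    pair_equations_iff (l := -l) (by rwa [neg_sq])]
  simp [criticalPoint, funext_iff, Fin.forall_fin_succ, ← sub_eq_add_neg]
  tauto

lemma multiplier_unique {w u x : Fin 4 → K} {l m : K} (hx : x ≠ 0)
    (hl : (fun i => w i * (x i - u i)) = l • ![x 3, -(x 2), -(x 1), x 0])
    (hm : (fun i => w i * (x i - u i)) = m • ![x 3, -(x 2), -(x 1), x 0]) : l = m := by
  have hg : ![x 3, -(x 2), -(x 1), x 0] ≠ 0 := by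
    contrapose hx
    simp only [funext_iff, Fin.forall_fin_succ] at hx ⊢
    simp at hx ⊢
    tauto
  exact smul_left_injective K hg (hl.symm.trans hm)

/-- Nondegeneracy of the weights and data: it makes the linear equations for `x` uniquely
solvable at every critical point and at every root of `multiplierPoly w u`. -/
structure IsNondegenerate (w u : Fin 4 → K) : Prop where
  w_ne_zero : ∀ i, w i ≠ 0
  det_ne : w 0 * w 3 - w 1 * w 2 ≠ 0
  outer_ne : w 0 * u 0 ^ 2 - w 3 * u 3 ^ 2 ≠ 0
  inner_ne : w 1 * u 1 ^ 2 - w 2 * u 2 ^ 2 ≠ 0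

lemma denominators_ne_zero_of_root {w u : Fin 4 → K} (h : IsNondegenerate w u) {l : K}
    (hl : (multiplierPoly w u).eval l = 0) :
    w 0 * w 3 - l ^ 2 ≠ 0 ∧ w 1 * w 2 - l ^ 2 ≠ 0 := by
  rw [eval_multiplierPoly] at hl
  have hA' : w 0 * w 3 - l ^ 2 ≠ 0 := by
    intro h0
    have hB' : w 1 * w 2 - l ^ 2 ≠ 0 := fun h1 => h.det_ne (by linear_combination h0 - h1)
    simp [h0, pair_factors_ne_zero (h.w_ne_zero 0) (h.w_ne_zero 3) h.outer_ne h0, hB'] at hl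
  refine ⟨hA', fun h0 => ?_⟩
  have := pair_factors_ne_zero (l := -l) (h.w_ne_zero 1) (h.w_ne_zero 2) h.inner_ne
    (by rwa [neg_sq])
  simp only [mul_neg, ← sub_eq_add_neg] at this
  simp [h0, hA', this] at hl

lemma criticalPoint_of_root {w u : Fin 4 → K} (h : IsNondegenerate w u) {l : K}
    (hl : (multiplierPoly w u).eval l = 0) :
    criticalPoint w u l ≠ 0 ∧
      (fun i => w i * (criticalPoint w u l i - u i)) =
        l • ![criticalPoint w u l 3, -(criticalPoint w u l 2), -(criticalPoint w u l 1),
          criticalPoint w u l 0] := by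
  obtain ⟨hA', hB'⟩ := denominators_ne_zero_of_root h hl
  have hl' := (gradient_equations_iff_eq_criticalPoint (u := u) hA' hB').2 rfl
  refine ⟨fun hx => h.outer_ne ?_, hl'⟩
  rw [hx] at hl'
  obtain ⟨⟨e0, e3⟩, -⟩ := (gradient_equations_iff w u 0 l).1 hl'
  simp only [Pi.zero_apply] at e0 e3
  linear_combination -u 0 * e0 + u 3 * e3

/-- For generic weights and data, the critical points are parametrized by the roots of
`multiplierPoly w u`. -/
lemma setOf_critical_eq_image {w u : Fin 4 → K} (h : IsNondegenerate w u) :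
    {x : Fin 4 → K | x ≠ 0 ∧ x 0 * x 3 - x 1 * x 2 = 0 ∧
        ∃ l : K, (fun i => w i * (x i - u i)) = l • ![x 3, -(x 2), -(x 1), x 0]} =
      criticalPoint w u '' {l | (multiplierPoly w u).eval l = 0} := by
  ext x
  constructor
  · rintro ⟨-, hx, l, hl⟩
    obtain ⟨⟨e0, e3⟩, e1, e2⟩ := (gradient_equations_iff w u x l).1 hl
    have hA' := sub_sq_ne_zero_of_pair_equations (h.w_ne_zero 0) (h.w_ne_zero 3) h.outer_ne e0 e3
    have hB' := sub_sq_ne_zero_of_pair_equations (h.w_ne_zero 1) (h.w_ne_zero 2) h.inner_ne e1 e2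
    rw [neg_sq] at hB'
    obtain rfl := (gradient_equations_iff_eq_criticalPoint hA' hB').1 hl
    exact ⟨l, (criticalPoint_mem_quadric_iff hA' hB').1 hx, rfl⟩
  · rintro ⟨l, hl, rfl⟩
    obtain ⟨hA', hB'⟩ := denominators_ne_zero_of_root h hl
    obtain ⟨hx, hl'⟩ := criticalPoint_of_root h hl
    exact ⟨hx, (criticalPoint_mem_quadric_iff hA' hB').2 hl, l, hl'⟩

lemma criticalPoint_injOn {w u : Fin 4 → K} (h : IsNondegenerate w u) :
    Set.InjOn (criticalPoint w u) {l | (multiplierPoly w u).eval l = 0} := by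
  intro l hl m hm hlm
  obtain ⟨hx, hl'⟩ := criticalPoint_of_root h hl
  obtain ⟨-, hm'⟩ := criticalPoint_of_root h hm
  rw [← hlm] at hm'
  exact multiplier_unique hx hl' hm'

lemma ncard_roots_multiplierPoly [IsAlgClosed K] [CharZero K] {w u : Fin 4 → K}
    (hl : multiplierLead w u ≠ 0)
    (hr : (multiplierPoly w u).resultant (multiplierPoly w u).derivative 6 5 ≠ 0) :
    {l | (multiplierPoly w u).eval l = 0}.ncard = 6 := by
  have hdeg := multiplierPoly_natDegree w u hl
  have hsep : (multiplierPoly w u).Separable := by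
    rw [Polynomial.separable_def]
    by_contra hc
    refine hr ?_
    have := Polynomial.resultant_eq_zero_iff.2
      ⟨Or.inl (Polynomial.ne_zero_of_natDegree_gt (n := 0) (by omega)), hc⟩
    rwa [hdeg, derivative_multiplierPoly_natDegree w u hl] at this
  have hcard := Polynomial.card_rootSet_eq_natDegree (K := K) hsep (IsAlgClosed.splits _)
  rw [← hdeg, ← hcard, ← Nat.card_eq_fintype_card, Nat.card_coe_set_eq]
  congr 1
  ext l
  simp [Polynomial.mem_rootSet', hsep.ne_zero]

end Field

/-- The generic Euclidean distance degree of the quadric `x₀x₃ - x₁x₂ = 0` is `6`: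
there is a nonzero polynomial `G` in the weights `w` and data `u` such that whenever
`G(w, u) ≠ 0`, the function `∑ᵢ wᵢ(xᵢ - uᵢ)²` has exactly `6` critical points on the
smooth locus of the affine cone, i.e. there are exactly `6` nonzero points `x` of the
cone at which `(wᵢ(xᵢ - uᵢ))ᵢ` is a scalar multiple of the gradient
`(x₃, -x₂, -x₁, x₀)`. -/
theorem stmt_5 :
    ∃ G : MvPolynomial (Fin 4 ⊕ Fin 4) ℂ, G ≠ 0 ∧
      ∀ w u : Fin 4 → ℂ, MvPolynomial.eval (Sum.elim w u) G ≠ 0 →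
        Set.ncard {x : Fin 4 → ℂ | x ≠ 0 ∧ x 0 * x 3 - x 1 * x 2 = 0 ∧
          ∃ l : ℂ, (fun i => w i * (x i - u i)) = l • ![x 3, -(x 2), -(x 1), x 0]} = 6 := by
  refine ⟨genericityExpr (fun i => .X (.inl i)) (fun i => .X (.inr i)), ?_, ?_⟩
  · intro h
    have := congrArg (MvPolynomial.eval
      (Sum.elim (![1, 4, -1, -1] : Fin 4 → ℂ) ![1, 1, 2, 1])) h
    rw [map_genericityExpr, map_zero] at this
    refine genericityExpr_witness ?_
    convert this using 2 <;> ext i <;> simp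
  · intro w u h
    rw [map_genericityExpr] at h
    have h' : genericityExpr w u ≠ 0 := by
      convert h using 2 <;> ext i <;> simp
    simp only [genericityExpr, mul_ne_zero_iff] at h'
    obtain ⟨⟨⟨⟨⟨⟨⟨⟨h0, h1⟩, h2⟩, h3⟩, hw⟩, hA⟩, hB⟩, hl⟩, hr⟩ := h'
    have hg : IsNondegenerate w u :=
      ⟨by simp [Fin.forall_fin_succ, h0, h1, h2, h3], hw, hA, hB⟩
    rw [setOf_critical_eq_image hg, (criticalPoint_injOn hg).ncard_image,
      ncard_roots_multiplierPoly hl hr]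
end

section
/- Let N be a positive natural number and fix r ∈ ℂ with r² = N. Then the set S = { (x₀, x₁, …, x_N, a, b) ∈ ℂ^{N+3} : x₁ = x₂ = ⋯ = x_N, r·x₀·x_N = a·b, and x₀² + x₁² + ⋯ + x_N² + a² + b² = 0 } is a union of four two-dimensional ℂ-linear subspaces of ℂ^{N+3}. -/
/-- The linear map `q ↦ ((f q, g q, …, g q), q)`. -/
def consGraph {K : Type*} [Field K] (N : ℕ) (f g : K × K →ₗ[K] K) :
    K × K →ₗ[K] (Fin (N + 1) → K) × K × K :=
  (LinearMap.pi fun i => if i = 0 then f else g).prod LinearMap.id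

theorem finrank_range_consGraph {K : Type*} [Field K] (N : ℕ) (f g : K × K →ₗ[K] K) :
    Module.finrank K (LinearMap.range (consGraph N f g)) = 2 := by
  rw [LinearMap.finrank_range_of_inj fun p q h => congrArg Prod.snd h]
  simp

theorem mem_range_consGraph {K : Type*} [Field K] {N : ℕ} (f g : K × K →ₗ[K] K)
    (p : (Fin (N + 1) → K) × K × K) :
    p ∈ LinearMap.range (consGraph N f g) ↔
      p.1 0 = f p.2 ∧ ∀ i, i ≠ 0 → p.1 i = g p.2 := by
  constructor
  · rintro ⟨q, rfl⟩
    simp +contextual [consGraph]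
  · rintro ⟨h0, h⟩
    refine ⟨p.2, Prod.ext (funext fun i => ?_) rfl⟩
    by_cases hi : i = 0
    · subst hi
      simp [consGraph, h0]
    · simp [consGraph, hi, h i hi]

/-- The Segre quadric `u v = a b` meets the isotropic quadric in four planes. -/
theorem segre_inter_isotropic_iff {K : Type*} [Field K] [CharZero K] {s : K}
    (hs : s ^ 2 = -1) (u v a b : K) :
    (u * v = a * b ∧ u ^ 2 + v ^ 2 + a ^ 2 + b ^ 2 = 0) ↔
      (((u = s * a ∧ v = -s * b) ∨ (u = -s * a ∧ v = s * b)) ∨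
        (u = s * b ∧ v = -s * a)) ∨ (u = -s * b ∧ v = s * a) := by
  constructor
  · rintro ⟨h1, h2⟩
    have hp : (u + v - s * (a - b)) * (u + v + s * (a - b)) = 0 := by
      linear_combination h2 + 2 * h1 - (a - b) ^ 2 * hs
    have hm : (u - v - s * (a + b)) * (u - v + s * (a + b)) = 0 := by
      linear_combination h2 - 2 * h1 - (a + b) ^ 2 * hs
    rcases mul_eq_zero.1 hp with hp | hp <;> rcases mul_eq_zero.1 hm with hm | hm
    · exact .inl (.inl (.inl ⟨by linear_combination (hp + hm) / 2,
        by linear_combination (hp - hm) / 2⟩))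
    · exact .inr ⟨by linear_combination (hp + hm) / 2, by linear_combination (hp - hm) / 2⟩
    · exact .inl (.inr ⟨by linear_combination (hp + hm) / 2,
        by linear_combination (hp - hm) / 2⟩)
    · exact .inl (.inl (.inr ⟨by linear_combination (hp + hm) / 2,
        by linear_combination (hp - hm) / 2⟩))
  · rintro (((⟨rfl, rfl⟩ | ⟨rfl, rfl⟩) | ⟨rfl, rfl⟩) | ⟨rfl, rfl⟩)
    all_goals
      exact ⟨by linear_combination -a * b * hs, by linear_combination (a ^ 2 + b ^ 2) * hs⟩


/-- The intersection of (the affine cone of) the McKeithan variety `Y_N`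
(homogenized with respect to `√N · x₀`) with the isotropic quadric is a union of
four two-dimensional linear subspaces of `ℂ^{N+3}`.  A point of `ℂ^{N+3}` is
recorded as a pair `p = (x, (a, b))` with `x : Fin (N+1) → ℂ` the coordinates
`x₀, …, x_N` and `a, b` the last two coordinates. -/
theorem stmt_7 (N : ℕ) (hN : 0 < N) (r : ℂ) (hr : r ^ 2 = (N : ℂ)) :
    ∃ V₁ V₂ V₃ V₄ : Submodule ℂ ((Fin (N + 1) → ℂ) × ℂ × ℂ),
      Module.finrank ℂ V₁ = 2 ∧ Module.finrank ℂ V₂ = 2 ∧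
      Module.finrank ℂ V₃ = 2 ∧ Module.finrank ℂ V₄ = 2 ∧
      {p : (Fin (N + 1) → ℂ) × ℂ × ℂ |
          (∀ i j : Fin (N + 1), i ≠ 0 → j ≠ 0 → p.1 i = p.1 j) ∧
          r * p.1 0 * p.1 (Fin.last N) = p.2.1 * p.2.2 ∧
          (∑ i, (p.1 i) ^ 2) + p.2.1 ^ 2 + p.2.2 ^ 2 = 0} =
        (V₁ : Set ((Fin (N + 1) → ℂ) × ℂ × ℂ)) ∪ V₂ ∪ V₃ ∪ V₄ := by
  have hr0 : r ≠ 0 := by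
    rintro rfl
    simp [eq_comm, hN.ne'] at hr
  have hlast : Fin.last N ≠ 0 := by simp [Fin.ext_iff, hN.ne']
  let A : ℂ × ℂ →ₗ[ℂ] ℂ := LinearMap.fst ℂ ℂ ℂ
  let B : ℂ × ℂ →ₗ[ℂ] ℂ := LinearMap.snd ℂ ℂ ℂ
  let V (f g : ℂ × ℂ →ₗ[ℂ] ℂ) : Submodule ℂ ((Fin (N + 1) → ℂ) × ℂ × ℂ) :=
    LinearMap.range (consGraph N f (r⁻¹ • g))
  have hV (f g : ℂ × ℂ →ₗ[ℂ] ℂ) (p : (Fin (N + 1) → ℂ) × ℂ × ℂ) : p ∈ V f g ↔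
      (∀ i j : Fin (N + 1), i ≠ 0 → j ≠ 0 → p.1 i = p.1 j) ∧
        p.1 0 = f p.2 ∧ r * p.1 (Fin.last N) = g p.2 := by
    rw [mem_range_consGraph]
    constructor
    · rintro ⟨h0, h⟩
      refine ⟨fun i j hi hj => (h i hi).trans (h j hj).symm, h0, ?_⟩
      simp [h _ hlast, hr0]
    · rintro ⟨h, h0, h1⟩
      refine ⟨h0, fun i hi => ?_⟩
      simp [h i _ hi hlast, ← h1, hr0]
  refine ⟨V (Complex.I • A) (-Complex.I • B), V (-Complex.I • A) (Complex.I • B),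
    V (Complex.I • B) (-Complex.I • A), V (-Complex.I • B) (Complex.I • A),
    finrank_range_consGraph .., finrank_range_consGraph .., finrank_range_consGraph ..,
    finrank_range_consGraph .., ?_⟩
  ext p
  simp only [Set.mem_union, SetLike.mem_coe, hV, Set.mem_ofPred_eq, ← and_or_left]
  refine and_congr_right fun h => ?_
  have hsum : ∑ i, p.1 i ^ 2 = p.1 0 ^ 2 + (r * p.1 (Fin.last N)) ^ 2 := by
    rw [Fin.sum_univ_succ, Finset.sum_congr rfl fun i _ => by
      rw [h i.succ (Fin.last N) (Fin.succ_ne_zero i) hlast]]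
    simp [mul_pow, hr]
  rw [hsum]
  have key := segre_inter_isotropic_iff Complex.I_sq (p.1 0) (r * p.1 (Fin.last N)) p.2.1 p.2.2
  rw [← mul_assoc, mul_comm (p.1 0) r] at key
  exact key
end

section
/- Let N ≥ 2 be a natural number. For every nonzero (x₀, t, a, b) ∈ ℂ⁴ satisfying x₀·t = a·b and x₀² + N·t² + a² + b² = 0, the two vectors (t, x₀, −b, −a) and (x₀, N·t, a, b) in ℂ⁴ are ℂ-linearly independent. -/
/-- For `N ≥ 2`, the cone of the McKeithan variety `X_N` meets the isotropic
quadric transversally: at every nonzero common zero `(x₀, t, a, b)` of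
`x₀ t - a b` and `x₀² + N t² + a² + b²`, the gradients `(t, x₀, -b, -a)` and
`(x₀, N t, a, b)` of the two defining equations are linearly independent. -/
theorem stmt_8 (N : ℕ) (hN : 2 ≤ N) (x₀ t a b : ℂ)
    (hne : ![x₀, t, a, b] ≠ 0)
    (h₁ : x₀ * t = a * b)
    (h₂ : x₀ ^ 2 + (N : ℂ) * t ^ 2 + a ^ 2 + b ^ 2 = 0) :
    LinearIndependent ℂ ![![t, x₀, -b, -a], ![x₀, (N : ℂ) * t, a, b]] := by
  rw [LinearIndependent.pair_iff]
  intro s r h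
  have e₀ : s * t + r * x₀ = 0 := by simpa using congrFun h 0
  have e₁ : s * x₀ + r * (N * t) = 0 := by simpa using congrFun h 1
  have e₂ : s * (-b) + r * a = 0 := by simpa using congrFun h 2
  have e₃ : s * (-a) + r * b = 0 := by simpa using congrFun h 3
  have hN₀ : (N : ℂ) ≠ 0 := by exact_mod_cast (by omega : N ≠ 0)
  have hN₁ : (N : ℂ) - 1 ≠ 0 := sub_ne_zero.mpr (by exact_mod_cast (by omega : N ≠ 1))
  by_cases hr : r = 0
  · refine ⟨?_, hr⟩
    by_contra hs
    subst hr
    simp_all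
  exfalso
  by_cases ht : t = 0
  · subst ht
    have hx : x₀ = 0 := by simpa [hr] using e₀
    rcases mul_eq_zero.mp (show a * b = 0 by simpa using h₁.symm) with rfl | rfl
    · simp_all
    · simp_all
  · have hsr : s ^ 2 = N * r ^ 2 := by
      apply mul_right_cancel₀ ht
      linear_combination s * e₀ - r * e₁
    have hab : a = 0 := by
      have : ((N : ℂ) - 1) * r ^ 2 * a = 0 := by
        linear_combination (-a) * hsr - r * e₂ - s * e₃
      simpa [hN₁, hr] using this
    have hx : x₀ = 0 := by simpa [hab, ht] using h₁
    simp_all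
end

section
/- Let i ∈ ℂ be the imaginary unit, fix s ∈ ℂ with s² = 2, and let F(x) = (x₁ − i·x₀)² + 2(x₃ − i·x₂)² + q(x) and q(x) = x₀² + x₁² + x₂² + x₃² for x = (x₀, x₁, x₂, x₃) ∈ ℂ⁴. Then { x ∈ ℂ⁴ : F(x) = 0 and q(x) = 0 } = L₁ ∪ L₂ ∪ L₃, where L₃ = { x : x₁ = i·x₀ and x₃ = i·x₂ }, L₁ = { x : x₁ − i·x₀ = i·s·(x₃ − i·x₂) and x₃ + i·x₂ = −i·s·(x₁ + i·x₀) }, and L₂ = { x : x₁ − i·x₀ = −i·s·(x₃ − i·x₂) and x₃ + i·x₂ = i·s·(x₁ + i·x₀) }. Each of L₁, L₂, L₃ is a two-dimensional ℂ-linear subspace of ℂ⁴. -/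
open Complex

/-- A plane in `K⁴` that is a graph over the coordinates `x₀, x₂` is a two-dimensional subspace. -/
theorem exists_submodule_finrank_two_of_graph {K : Type*} [Field K] (a b c d : K) :
    ∃ W : Submodule K (Fin 4 → K), Module.finrank K W = 2 ∧
      (W : Set (Fin 4 → K)) =
        {x : Fin 4 → K | x 1 = a * x 0 + b * x 2 ∧ x 3 = c * x 0 + d * x 2} := by
  let f : (Fin 2 → K) →ₗ[K] (Fin 4 → K) :=
    Matrix.toLin' !![1, 0; a, b; 0, 1; c, d]
  have hf (y : Fin 2 → K) : f y = ![y 0, a * y 0 + b * y 1, y 1, c * y 0 + d * y 1] := by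
    ext j
    fin_cases j <;> simp [f, Matrix.toLin'_apply, Matrix.mulVec, dotProduct, Fin.sum_univ_two]
  refine ⟨LinearMap.range f, ?_, ?_⟩
  · rw [LinearMap.finrank_range_of_inj, Module.finrank_fin_fun]
    intro y z h
    rw [hf, hf] at h
    ext j
    fin_cases j
    · simpa using congrFun h 0
    · simpa using congrFun h 2
  · ext x
    simp only [SetLike.mem_coe, LinearMap.mem_range, Set.mem_ofPred_eq]
    constructor
    · rintro ⟨y, rfl⟩
      simp [hf]
    · rintro ⟨h₁, h₃⟩
      refine ⟨![x 0, x 2], ?_⟩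
      rw [hf]
      ext j
      fin_cases j <;> simp [h₁, h₃]

/-- For `t² = -2`, the equations of the plane `x₁ - i x₀ = t (x₃ - i x₂)`,
`x₃ + i x₂ = -t (x₁ + i x₀)` solved for `x₁` and `x₃`. -/
theorem plane_equations_iff_graph {t : ℂ} (ht : t ^ 2 = -2) (x₀ x₁ x₂ x₃ : ℂ) :
    (x₁ - I * x₀ = t * (x₃ - I * x₂) ∧ x₃ + I * x₂ = -t * (x₁ + I * x₀)) ↔
      x₁ = -3 * I * x₀ + 2 * t * I * x₂ ∧ x₃ = 2 * t * I * x₀ + 3 * I * x₂ := by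
  constructor
  · rintro ⟨h₁, h₂⟩
    constructor
    · linear_combination -h₁ - t * h₂ + (x₁ + I * x₀) * ht
    · linear_combination t * h₁ - h₂ + (x₃ - I * x₂) * ht
  · rintro ⟨rfl, rfl⟩
    constructor
    · linear_combination (-2 * I * x₀) * ht
    · linear_combination (2 * I * x₂) * ht

/-- For the quadric `F = (x₁ - i x₀)² + 2(x₃ - i x₂)² + q` with
`q = x₀² + x₁² + x₂² + x₃²`, the common zero set of `F` and `q` in `ℂ⁴` is the
union of three two-dimensional linear subspaces `L₁ ∪ L₂ ∪ L₃`. -/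
theorem stmt_9 (s : ℂ) (hs : s ^ 2 = 2) :
    ({x : Fin 4 → ℂ |
        (x 1 - I * x 0) ^ 2 + 2 * (x 3 - I * x 2) ^ 2 +
          ((x 0) ^ 2 + (x 1) ^ 2 + (x 2) ^ 2 + (x 3) ^ 2) = 0 ∧
        (x 0) ^ 2 + (x 1) ^ 2 + (x 2) ^ 2 + (x 3) ^ 2 = 0} =
      {x : Fin 4 → ℂ | x 1 - I * x 0 = I * s * (x 3 - I * x 2) ∧
          x 3 + I * x 2 = -(I * s) * (x 1 + I * x 0)} ∪
      {x : Fin 4 → ℂ | x 1 - I * x 0 = -(I * s) * (x 3 - I * x 2) ∧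
          x 3 + I * x 2 = I * s * (x 1 + I * x 0)} ∪
      {x : Fin 4 → ℂ | x 1 = I * x 0 ∧ x 3 = I * x 2}) ∧
    (∃ W₁ : Submodule ℂ (Fin 4 → ℂ), Module.finrank ℂ W₁ = 2 ∧
        (W₁ : Set (Fin 4 → ℂ)) =
          {x : Fin 4 → ℂ | x 1 - I * x 0 = I * s * (x 3 - I * x 2) ∧
            x 3 + I * x 2 = -(I * s) * (x 1 + I * x 0)}) ∧
    (∃ W₂ : Submodule ℂ (Fin 4 → ℂ), Module.finrank ℂ W₂ = 2 ∧
        (W₂ : Set (Fin 4 → ℂ)) =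
          {x : Fin 4 → ℂ | x 1 - I * x 0 = -(I * s) * (x 3 - I * x 2) ∧
            x 3 + I * x 2 = I * s * (x 1 + I * x 0)}) ∧
    (∃ W₃ : Submodule ℂ (Fin 4 → ℂ), Module.finrank ℂ W₃ = 2 ∧
        (W₃ : Set (Fin 4 → ℂ)) = {x : Fin 4 → ℂ | x 1 = I * x 0 ∧ x 3 = I * x 2}) := by
  have ht : (I * s) ^ 2 = -2 := by rw [mul_pow, I_sq, hs]; ring
  have ht' : (-(I * s)) ^ 2 = -2 := by rw [neg_sq, ht]
  refine ⟨?_, ?_, ?_, ?_⟩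
  · ext x
    simp only [Set.mem_union, Set.mem_ofPred_eq]
    generalize I * s = t at ht
    have hq : x 0 ^ 2 + x 1 ^ 2 + x 2 ^ 2 + x 3 ^ 2 =
        (x 1 - I * x 0) * (x 1 + I * x 0) + (x 3 - I * x 2) * (x 3 + I * x 2) := by
      linear_combination (x 0 ^ 2 + x 2 ^ 2) * I_sq
    rw [hq, ← sub_eq_zero (a := x 1) (b := I * x 0), ← sub_eq_zero (a := x 3) (b := I * x 2)]
    generalize x 1 - I * x 0 = a, x 1 + I * x 0 = b, x 3 - I * x 2 = c, x 3 + I * x 2 = d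
    constructor
    · rintro ⟨h, h₀⟩
      by_cases hc : c = 0
      · subst hc
        exact .inr ⟨pow_eq_zero_iff two_ne_zero |>.1 (by linear_combination h - h₀), rfl⟩
      · left
        have hac : (a - t * c) * (a + t * c) = 0 := by
          linear_combination h - h₀ - c ^ 2 * ht
        rcases mul_eq_zero.1 hac with ha | ha
        · refine .inl ⟨by linear_combination ha, mul_left_cancel₀ hc ?_⟩
          linear_combination h₀ - b * ha
        · refine .inr ⟨by linear_combination ha, mul_left_cancel₀ hc ?_⟩
          linear_combination h₀ - b * ha
    · rintro ((⟨rfl, rfl⟩ | ⟨rfl, rfl⟩) | ⟨rfl, rfl⟩)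
      · exact ⟨by linear_combination c ^ 2 * ht, by ring⟩
      · exact ⟨by linear_combination c ^ 2 * ht, by ring⟩
      · simp
  · simp only [plane_equations_iff_graph ht]
    exact exists_submodule_finrank_two_of_graph ..
  · have h (x : Fin 4 → ℂ) := plane_equations_iff_graph ht' (x 0) (x 1) (x 2) (x 3)
    simp only [neg_neg (I * s)] at h
    simp only [h]
    exact exists_submodule_finrank_two_of_graph ..
  · simpa using exists_submodule_finrank_two_of_graph I 0 0 I
end

section
/- Let i ∈ ℂ be the imaginary unit and let F(x) = (x₁ − i·x₀)² + 2(x₃ − i·x₂)² + q(x) with q(x) = x₀² + x₁² + x₂² + x₃², and let ∇F(x) = 2(x₁ − i·x₀)·(−i, 1, 0, 0) + 4(x₃ − i·x₂)·(0, 0, −i, 1) + 2x and ∇q(x) = 2x denote the gradients. Then { x ∈ ℂ⁴ : x ≠ 0, F(x) = 0, q(x) = 0, and ∇F(x), ∇q(x) are ℂ-linearly dependent in ℂ⁴ } = { x ∈ ℂ⁴ : x ≠ 0, x₁ = i·x₀, x₃ = i·x₂ }. -/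
open Complex

/-- For the quadric `F = (x₁ - i x₀)² + 2(x₃ - i x₂)² + q` with
`q = x₀² + x₁² + x₂² + x₃²`, the locus of nonzero common zeros of `F` and `q` at
which the gradients `∇F` and `∇q` are linearly dependent is exactly the punctured
plane `{x ≠ 0 : x₁ = i x₀, x₃ = i x₂}`. -/
theorem stmt_10 :
    {x : Fin 4 → ℂ | x ≠ 0 ∧
        (x 1 - I * x 0) ^ 2 + 2 * (x 3 - I * x 2) ^ 2 +
          ((x 0) ^ 2 + (x 1) ^ 2 + (x 2) ^ 2 + (x 3) ^ 2) = 0 ∧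
        (x 0) ^ 2 + (x 1) ^ 2 + (x 2) ^ 2 + (x 3) ^ 2 = 0 ∧
        ¬ LinearIndependent ℂ
          ![(2 * (x 1 - I * x 0)) • ![-I, 1, 0, 0] +
              (4 * (x 3 - I * x 2)) • ![0, 0, -I, 1] + (2 : ℂ) • x,
            (2 : ℂ) • x]} =
      {x : Fin 4 → ℂ | x ≠ 0 ∧ x 1 = I * x 0 ∧ x 3 = I * x 2} := by
  ext x
  simp only [Set.mem_ofPred_eq, LinearIndependent.pair_iff]
  constructor
  · rintro ⟨hx, -, -, hdep⟩
    refine ⟨hx, ?_⟩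
    push Not at hdep
    obtain ⟨s, t, hst, hne⟩ := hdep
    have h0 := congrFun hst 0
    have h1 := congrFun hst 1
    have h2 := congrFun hst 2
    have h3 := congrFun hst 3
    simp only [Pi.add_apply, Pi.smul_apply, Pi.zero_apply, smul_eq_mul] at h0 h1 h2 h3
    simp at h0 h1 h2 h3
    have hs : s ≠ 0 := by
      rintro rfl
      have ht : t ≠ 0 := hne rfl
      apply hx
      ext j
      fin_cases j <;> simp_all
    by_cases hc : s + t = 0
    · obtain rfl : t = -s := by linear_combination hc
      constructor
      · apply mul_left_cancel₀ hs
        linear_combination h1 / 2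
      · apply mul_left_cancel₀ hs
        linear_combination h3 / 4
    · constructor
      · apply mul_left_cancel₀ hc
        linear_combination (h1 - I * h0) / 2 - s * (x 1 - I * x 0) * I_sq
      · apply mul_left_cancel₀ hc
        linear_combination (h3 - I * h2) / 2 - 2 * s * (x 3 - I * x 2) * I_sq
  · rintro ⟨hx, h1, h3⟩
    refine ⟨hx, ?_, ?_, ?_⟩
    · rw [h1, h3]
      linear_combination (x 0 ^ 2 + x 2 ^ 2) * I_sq
    · rw [h1, h3]
      linear_combination (x 0 ^ 2 + x 2 ^ 2) * I_sq
    · intro h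
      have := (h 1 (-1) (by simp [h1, h3])).1
      exact one_ne_zero this
end

section
/- Let i ∈ ℂ be the imaginary unit and let F(x) = (x₁ − i·x₀)² + 2(x₃ − i·x₂)² + x₀² + x₁² + x₂² + x₃² for x ∈ ℂ⁴, with gradient ∇F(x) = 2(x₁ − i·x₀)·(−i, 1, 0, 0) + 4(x₃ − i·x₂)·(0, 0, −i, 1) + 2x. There exists a nonzero polynomial G in eight complex variables such that for every (w, u) ∈ ℂ⁴ × ℂ⁴ with G(w, u) ≠ 0, the set { x ∈ ℂ⁴ : x ≠ 0, F(x) = 0, and there exists λ ∈ ℂ with (w₀(x₀ − u₀), w₁(x₁ − u₁), w₂(x₂ − u₂), w₃(x₃ − u₃)) = λ·∇F(x) } has exactly 6 elements. -/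
open Complex

namespace QuadricED

open Polynomial

/-- If two polynomials over `ℂ[σ]` keep their formal degrees and become coprime at one point,
then they become coprime at a generic point. -/
lemma exists_generic_isCoprime {σ : Type*} (P Q : (MvPolynomial σ ℂ)[X]) (m n : ℕ)
    (hP : P.natDegree ≤ m) (hQ : Q.natDegree ≤ n) (hm : m ≠ 0) (p : σ → ℂ)
    (hPp : (P.map (MvPolynomial.eval p)).natDegree = m)
    (hQp : (Q.map (MvPolynomial.eval p)).natDegree = n)
    (hcop : IsCoprime (P.map (MvPolynomial.eval p)) (Q.map (MvPolynomial.eval p))) :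
    ∃ G : MvPolynomial σ ℂ, G ≠ 0 ∧ ∀ q : σ → ℂ, MvPolynomial.eval q G ≠ 0 →
      IsCoprime (P.map (MvPolynomial.eval q)) (Q.map (MvPolynomial.eval q)) := by
  refine ⟨resultant P Q m n, fun h => ?_, fun q hq => ?_⟩
  · have := resultant_ne_zero _ _ hcop
    rw [hPp, hQp, resultant_map_map, h, map_zero] at this
    exact this rfl
  · obtain ⟨a, b, -, -, hab⟩ := exists_mul_add_mul_eq_C_resultant P Q hP hQ (.inl hm)
    have h := congrArg (Polynomial.map (MvPolynomial.eval q)) hab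
    simp only [Polynomial.map_add, Polynomial.map_mul, map_C] at h
    set r := MvPolynomial.eval q (resultant P Q m n)
    refine ⟨C r⁻¹ * a.map (MvPolynomial.eval q), C r⁻¹ * b.map (MvPolynomial.eval q), ?_⟩
    calc _ = C r⁻¹ * (P.map (MvPolynomial.eval q) * a.map (MvPolynomial.eval q) +
              Q.map (MvPolynomial.eval q) * b.map (MvPolynomial.eval q)) := by ring
      _ = 1 := by rw [h, ← C_mul, inv_mul_cancel₀ hq, C_1]

section Polynomials

variable {A : Type*} [CommRing A]

/-- Determinant of the critical equations in `x₀, x₁`, as a polynomial in the multiplier. -/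
noncomputable def det₁ (w : Fin 4 → A) : A[X] :=
  C 4 * X ^ 2 - C (4 * w 0) * X + C (w 0 * w 1)

/-- Determinant of the critical equations in `x₂, x₃`, as a polynomial in the multiplier. -/
noncomputable def det₂ (w : Fin 4 → A) : A[X] :=
  C 4 * X ^ 2 + C (2 * w 3 - 6 * w 2) * X + C (w 2 * w 3)

/-- Numerators of Cramer's rule for the critical equations; `i` is a square root of `-1`. -/
noncomputable def num (i : A) (w u : Fin 4 → A) : Fin 4 → A[X] :=
  ![C (-4 * (w 0 * u 0) - 2 * i * (w 1 * u 1)) * X + C (w 1 * (w 0 * u 0)),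
    C (-2 * i * (w 0 * u 0)) * X + C (w 0 * (w 1 * u 1)),
    C (-6 * (w 2 * u 2) - 4 * i * (w 3 * u 3)) * X + C (w 3 * (w 2 * u 2)),
    C (2 * (w 3 * u 3) - 4 * i * (w 2 * u 2)) * X + C (w 2 * (w 3 * u 3))]

/-- The sextic whose roots are the multipliers of the critical points. -/
noncomputable def sextic (i : A) (w u : Fin 4 → A) : A[X] :=
  C 2 * num i w u 1 * (num i w u 1 - C i * num i w u 0) * det₂ w ^ 2 +
    (num i w u 3 - C i * num i w u 2) * (C 3 * num i w u 3 - C i * num i w u 2) * det₁ w ^ 2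

lemma natDegree_det₁_le (w : Fin 4 → A) : (det₁ w).natDegree ≤ 2 := by
  unfold det₁; compute_degree

lemma natDegree_det₂_le (w : Fin 4 → A) : (det₂ w).natDegree ≤ 2 := by
  unfold det₂; compute_degree

lemma natDegree_sextic_le (i : A) (w u : Fin 4 → A) : (sextic i w u).natDegree ≤ 6 := by
  simp only [sextic, num, det₁, det₂, Matrix.cons_val]
  compute_degree

variable {B : Type*} [CommRing B] (φ : A →+* B)

lemma map_det₁ (w : Fin 4 → A) : (det₁ w).map φ = det₁ (φ ∘ w) := by
  simp [det₁, map_ofNat φ]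

lemma map_det₂ (w : Fin 4 → A) : (det₂ w).map φ = det₂ (φ ∘ w) := by
  simp [det₂, map_ofNat φ]

lemma map_sextic (i : A) (w u : Fin 4 → A) :
    (sextic i w u).map φ = sextic (φ i) (φ ∘ w) (φ ∘ u) := by
  simp [sextic, num, det₁, det₂, map_ofNat φ]

end Polynomials

/-- The critical points, described by the multiplier equations. -/
def criticalSet (w u : Fin 4 → ℂ) : Set (Fin 4 → ℂ) :=
  {x : Fin 4 → ℂ | x ≠ 0 ∧
    (x 1 - I * x 0) ^ 2 + 2 * (x 3 - I * x 2) ^ 2 +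
      ((x 0) ^ 2 + (x 1) ^ 2 + (x 2) ^ 2 + (x 3) ^ 2) = 0 ∧
    ∃ l : ℂ, (fun i => w i * (x i - u i)) =
      l • ((2 * (x 1 - I * x 0)) • ![-I, 1, 0, 0] +
        (4 * (x 3 - I * x 2)) • ![0, 0, -I, 1] + (2 : ℂ) • x)}

lemma multiplier_iff (w u x : Fin 4 → ℂ) (l : ℂ) :
    (fun i => w i * (x i - u i)) =
      l • ((2 * (x 1 - I * x 0)) • ![-I, 1, 0, 0] +
        (4 * (x 3 - I * x 2)) • ![0, 0, -I, 1] + (2 : ℂ) • x) ↔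
    w 0 * (x 0 - u 0) = l * (-2 * I * x 1) ∧
    w 1 * (x 1 - u 1) = l * (4 * x 1 - 2 * I * x 0) ∧
    w 2 * (x 2 - u 2) = l * (-4 * I * x 3 - 2 * x 2) ∧
    w 3 * (x 3 - u 3) = l * (6 * x 3 - 4 * I * x 2) := by
  have expand : l • ((2 * (x 1 - I * x 0)) • ![-I, 1, 0, 0] +
        (4 * (x 3 - I * x 2)) • ![0, 0, -I, 1] + (2 : ℂ) • x) =
      ![l * (-2 * I * x 1), l * (4 * x 1 - 2 * I * x 0), l * (-4 * I * x 3 - 2 * x 2),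
        l * (6 * x 3 - 4 * I * x 2)] := by
    ext j
    fin_cases j <;> simp only [Fin.zero_eta, Fin.mk_one, Fin.reduceFinMk, Pi.smul_apply,
      Pi.add_apply, smul_eq_mul, Matrix.cons_val]
    · linear_combination 2 * l * x 0 * I_sq
    · ring
    · linear_combination 4 * l * x 2 * I_sq
    · ring
  rw [expand]
  simp [funext_iff, Fin.forall_fin_succ]

lemma eval_det₁ (w : Fin 4 → ℂ) (l : ℂ) :
    (det₁ w).eval l = 4 * l ^ 2 - 4 * w 0 * l + w 0 * w 1 := by
  simp [det₁]

lemma eval_det₂ (w : Fin 4 → ℂ) (l : ℂ) :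
    (det₂ w).eval l = 4 * l ^ 2 + (2 * w 3 - 6 * w 2) * l + w 2 * w 3 := by
  simp [det₂]

lemma quadric_factor (x : Fin 4 → ℂ) :
    (x 1 - I * x 0) ^ 2 + 2 * (x 3 - I * x 2) ^ 2 +
      ((x 0) ^ 2 + (x 1) ^ 2 + (x 2) ^ 2 + (x 3) ^ 2) =
    2 * x 1 * (x 1 - I * x 0) + (x 3 - I * x 2) * (3 * x 3 - I * x 2) := by
  linear_combination (x 0 ^ 2 + x 2 ^ 2) * I_sq

lemma eval_sextic (w u : Fin 4 → ℂ) (l : ℂ) :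
    (sextic I w u).eval l =
      2 * (num I w u 1).eval l * ((num I w u 1).eval l - I * (num I w u 0).eval l) *
          (det₂ w).eval l ^ 2 +
        ((num I w u 3).eval l - I * (num I w u 2).eval l) *
          (3 * (num I w u 3).eval l - I * (num I w u 2).eval l) * (det₁ w).eval l ^ 2 := by
  simp [sextic]

/-- Cramer's rule for the critical equations. -/
lemma cramer {w u x : Fin 4 → ℂ} {l : ℂ}
    (h : w 0 * (x 0 - u 0) = l * (-2 * I * x 1) ∧
      w 1 * (x 1 - u 1) = l * (4 * x 1 - 2 * I * x 0) ∧
      w 2 * (x 2 - u 2) = l * (-4 * I * x 3 - 2 * x 2) ∧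
      w 3 * (x 3 - u 3) = l * (6 * x 3 - 4 * I * x 2)) :
    (num I w u 0).eval l = (det₁ w).eval l * x 0 ∧
    (num I w u 1).eval l = (det₁ w).eval l * x 1 ∧
    (num I w u 2).eval l = (det₂ w).eval l * x 2 ∧
    (num I w u 3).eval l = (det₂ w).eval l * x 3 := by
  obtain ⟨h0, h1, h2, h3⟩ := h
  rw [eval_det₁, eval_det₂]
  simp only [num, Matrix.cons_val, eval_add, eval_mul, eval_C, eval_X]
  refine ⟨?_, ?_, ?_, ?_⟩
  · linear_combination (-(w 1 - 4 * l)) * h0 + 2 * I * l * h1 - 4 * l ^ 2 * x 0 * I_sq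
  · linear_combination (-w 0) * h1 + 2 * I * l * h0 - 4 * l ^ 2 * x 1 * I_sq
  · linear_combination (-(w 3 - 6 * l)) * h2 + 4 * I * l * h3 - 16 * l ^ 2 * x 2 * I_sq
  · linear_combination (-(w 2 + 2 * l)) * h3 + 4 * I * l * h2 - 16 * l ^ 2 * x 3 * I_sq

/-- The critical point with a given multiplier. -/
noncomputable def criticalPoint (w u : Fin 4 → ℂ) (l : ℂ) : Fin 4 → ℂ :=
  ![(num I w u 0).eval l / (det₁ w).eval l, (num I w u 1).eval l / (det₁ w).eval l,
    (num I w u 2).eval l / (det₂ w).eval l, (num I w u 3).eval l / (det₂ w).eval l]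

lemma criticalPoint_spec (w u : Fin 4 → ℂ) (l : ℂ) (h1 : (det₁ w).eval l ≠ 0)
    (h2 : (det₂ w).eval l ≠ 0) :
    let x := criticalPoint w u l
    w 0 * (x 0 - u 0) = l * (-2 * I * x 1) ∧
    w 1 * (x 1 - u 1) = l * (4 * x 1 - 2 * I * x 0) ∧
    w 2 * (x 2 - u 2) = l * (-4 * I * x 3 - 2 * x 2) ∧
    w 3 * (x 3 - u 3) = l * (6 * x 3 - 4 * I * x 2) := by
  have e1 := eval_det₁ w l
  have e2 := eval_det₂ w l
  simp only [criticalPoint, Matrix.cons_val]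
  set d1 := (det₁ w).eval l
  set d2 := (det₂ w).eval l
  simp only [num, Matrix.cons_val, eval_add, eval_mul, eval_C, eval_X]
  refine ⟨?_, ?_, ?_, ?_⟩ <;> field_simp
  · rw [e1]; linear_combination (-4 * w 0 * u 0 * l ^ 2) * I_sq
  · rw [e1]; linear_combination (-4 * w 1 * u 1 * l ^ 2) * I_sq
  · rw [e2]; linear_combination (-16 * w 2 * u 2 * l ^ 2) * I_sq
  · rw [e2]; linear_combination (-16 * w 3 * u 3 * l ^ 2) * I_sq

lemma criticalSet_eq_image (w u : Fin 4 → ℂ) (hw : w 0 ≠ 0) (hu : u 0 ≠ 0)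
    (hd1 : ∀ l, (sextic I w u).eval l = 0 → (det₁ w).eval l ≠ 0)
    (hd2 : ∀ l, (sextic I w u).eval l = 0 → (det₂ w).eval l ≠ 0) :
    criticalSet w u = criticalPoint w u '' {l | (sextic I w u).eval l = 0} := by
  ext x
  simp only [criticalSet, Set.mem_ofPred_eq, Set.mem_image, multiplier_iff, quadric_factor]
  constructor
  · rintro ⟨-, hF, l, hl⟩
    obtain ⟨c0, c1, c2, c3⟩ := cramer hl
    have hs : (sextic I w u).eval l = 0 := by
      rw [eval_sextic, c0, c1, c2, c3]
      linear_combination (eval l (det₁ w)) ^ 2 * (eval l (det₂ w)) ^ 2 * hF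
    have h1 := hd1 l hs
    have h2 := hd2 l hs
    refine ⟨l, hs, ?_⟩
    ext j
    fin_cases j <;> simp [criticalPoint, *]
  · rintro ⟨l, hs, rfl⟩
    have h1 := hd1 l hs
    have h2 := hd2 l hs
    have hl := criticalPoint_spec w u l h1 h2
    refine ⟨fun h0 => ?_, ?_, l, hl⟩
    · have := hl.1
      simp [h0, hw, hu] at this
    · obtain ⟨c0, c1, c2, c3⟩ := cramer hl
      rw [eval_sextic, c0, c1, c2, c3] at hs
      have : (eval l (det₁ w)) ^ 2 * (eval l (det₂ w)) ^ 2 ≠ 0 := by positivity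
      refine (mul_eq_zero.mp ?_).resolve_left this
      linear_combination hs

lemma criticalPoint_injOn (w u : Fin 4 → ℂ) (hw : w 0 ≠ 0) (hu : u 0 ≠ 0) :
    Set.InjOn (criticalPoint w u) {l | (det₁ w).eval l ≠ 0 ∧ (det₂ w).eval l ≠ 0} := by
  rintro l ⟨h1, h2⟩ m ⟨k1, k2⟩ hlm
  obtain ⟨a0, a1, -, -⟩ := criticalPoint_spec w u l h1 h2
  obtain ⟨b0, b1, -, -⟩ := criticalPoint_spec w u m k1 k2
  rw [← hlm] at b0 b1
  set x := criticalPoint w u l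
  by_contra hne
  have hne : l - m ≠ 0 := sub_ne_zero.mpr hne
  have hx1 : x 1 = 0 := by
    refine (mul_eq_zero.mp (?_ : (2 * I * (l - m)) * x 1 = 0)).resolve_left (by simp [hne])
    linear_combination a0 - b0
  have hx0 : x 0 = 0 := by
    refine (mul_eq_zero.mp (?_ : (2 * I * (l - m)) * x 0 = 0)).resolve_left (by simp [hne])
    linear_combination a1 - b1 + 4 * (l - m) * hx1
  simp [hx0, hx1, hw, hu] at a0

lemma ncard_criticalSet (w u : Fin 4 → ℂ) (hw : w 0 ≠ 0) (hu : u 0 ≠ 0)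
    (hdeg : (sextic I w u).coeff 6 ≠ 0)
    (hsep : IsCoprime (sextic I w u) (derivative (sextic I w u)))
    (h1 : IsCoprime (sextic I w u) (det₁ w)) (h2 : IsCoprime (sextic I w u) (det₂ w)) :
    (criticalSet w u).ncard = 6 := by
  have hd1 : ∀ l, (sextic I w u).eval l = 0 → (det₁ w).eval l ≠ 0 := by
    intro l hl
    have := h1.map (evalRingHom l)
    simpa [hl, isCoprime_zero_left] using this
  have hd2 : ∀ l, (sextic I w u).eval l = 0 → (det₂ w).eval l ≠ 0 := by
    intro l hl
    have := h2.map (evalRingHom l)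
    simpa [hl, isCoprime_zero_left] using this
  have hne : sextic I w u ≠ 0 := by rintro h; simp [h] at hdeg
  rw [criticalSet_eq_image w u hw hu hd1 hd2, Set.InjOn.ncard_image]
  · have hset : {l | (sextic I w u).eval l = 0} = (sextic I w u).rootSet ℂ := by
      ext l; simp [mem_rootSet, hne]
    rw [hset, ← Nat.card_coe_set_eq, Nat.card_eq_fintype_card,
      card_rootSet_eq_natDegree hsep (IsAlgClosed.splits _)]
    exact le_antisymm (natDegree_sextic_le _ _ _) (le_natDegree_of_ne_zero hdeg)
  · exact Set.InjOn.mono (fun l hl => And.intro (hd1 l hl) (hd2 l hl)) (criticalPoint_injOn w u hw hu)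

section SpecialPoint

/-- Weights at which the sextic is separable and coprime to both determinants. -/
def specialWeight : Fin 4 → ℂ := ![-1, -3, -2, -1]

/-- Data at which the sextic is separable and coprime to both determinants. -/
noncomputable def specialData : Fin 4 → ℂ := ![-1, 0, -I, 0]

lemma det₁_special : det₁ specialWeight = C 4 * X ^ 2 + C 4 * X + C 3 := by
  simp [det₁, specialWeight]

lemma det₂_special : det₂ specialWeight = C 4 * X ^ 2 + C 10 * X + C 2 := by
  simp only [det₂, specialWeight, Matrix.cons_val]
  norm_num

lemma sextic_special : sextic I specialWeight specialData =
    C (-640) * X ^ 6 + C (-960) * X ^ 5 + C (-480) * X ^ 4 + C 48 * X ^ 3 + C (-144) * X ^ 2 +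
      C 36 := by
  refine funext fun l => ?_
  rw [eval_sextic]
  simp only [num, det₁, det₂, specialWeight, specialData, Matrix.cons_val, eval_add, eval_mul,
    eval_sub, eval_pow, eval_C, eval_X]
  ring_nf
  simp only [I_sq, I_pow_four]
  ring_nf

lemma natDegree_det₁_special : (det₁ specialWeight).natDegree = 2 := by
  rw [det₁_special]; compute_degree!

lemma natDegree_det₂_special : (det₂ specialWeight).natDegree = 2 := by
  rw [det₂_special]; compute_degree!

lemma natDegree_sextic_special : (sextic I specialWeight specialData).natDegree = 6 := by
  rw [sextic_special]; compute_degree!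

lemma derivative_sextic_special : derivative (sextic I specialWeight specialData) =
    C (-3840) * X ^ 5 + C (-4800) * X ^ 4 + C (-1920) * X ^ 3 + C 144 * X ^ 2 + C (-288) * X := by
  rw [sextic_special]
  refine funext fun l => ?_
  simp
  ring

lemma natDegree_derivative_sextic_special :
    (derivative (sextic I specialWeight specialData)).natDegree = 5 := by
  rw [derivative_sextic_special]; compute_degree!

lemma isCoprime_of_eval {f g : ℂ[X]} (a b : ℂ[X]) {c : ℂ} (hc : c ≠ 0)
    (h : ∀ l, a.eval l * f.eval l + b.eval l * g.eval l = c) : IsCoprime f g := by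
  refine ⟨C c⁻¹ * a, C c⁻¹ * b, funext fun l => ?_⟩
  simp only [eval_add, eval_mul, eval_C, eval_one]
  linear_combination c⁻¹ * h l + inv_mul_cancel₀ hc

lemma sextic_special_separable : IsCoprime (sextic I specialWeight specialData)
    (derivative (sextic I specialWeight specialData)) := by
  rw [derivative_sextic_special, sextic_special]
  refine isCoprime_of_eval
    (C 28560 * X ^ 4 + C 24660 * X ^ 3 + C 8700 * X ^ 2 + C 2424 * X + C 6936)
    (C (-4760) * X ^ 5 + C (-5300) * X ^ 4 + C (-2180) * X ^ 3 + C (-108) * X ^ 2 +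
      C (-2229) * X + C 303) (c := 249696) (by norm_num) fun l => ?_
  simp only [eval_add, eval_mul, eval_C, eval_X, eval_pow]
  ring

lemma sextic_special_isCoprime_det₁ :
    IsCoprime (sextic I specialWeight specialData) (det₁ specialWeight) := by
  rw [sextic_special, det₁_special]
  refine isCoprime_of_eval (C (-94) * X + C (-19))
    (C (-15040) * X ^ 5 + C (-10560) * X ^ 4 + C 6000 * X ^ 3 + C 768 * X ^ 2 +
      C (-8424) * X + C 7164) (c := 20808) (by norm_num) fun l => ?_
  simp only [eval_add, eval_mul, eval_C, eval_X, eval_pow]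
  ring

lemma sextic_special_isCoprime_det₂ :
    IsCoprime (sextic I specialWeight specialData) (det₂ specialWeight) := by
  rw [sextic_special, det₂_special]
  refine isCoprime_of_eval (C 161 * X + C 367)
    (C 25760 * X ^ 5 + C 32960 * X ^ 4 + C 12120 * X ^ 3 + C (-4672) * X ^ 2 +
      C 7012 * X + C (-1982)) (c := 9248) (by norm_num) fun l => ?_
  simp only [eval_add, eval_mul, eval_C, eval_X, eval_pow]
  ring

end SpecialPoint

section Generic

/-- The generic weights. -/
noncomputable def genericWeight : Fin 4 → MvPolynomial (Fin 4 ⊕ Fin 4) ℂ :=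
  fun j => MvPolynomial.X (Sum.inl j)

/-- The sextic for generic weights and data. -/
noncomputable def genericSextic : (MvPolynomial (Fin 4 ⊕ Fin 4) ℂ)[X] :=
  sextic (MvPolynomial.C I) genericWeight fun j => MvPolynomial.X (Sum.inr j)

lemma eval_comp_genericWeight (w u : Fin 4 → ℂ) :
    MvPolynomial.eval (Sum.elim w u) ∘ genericWeight = w := by
  ext j; simp [genericWeight]

lemma map_genericSextic (w u : Fin 4 → ℂ) :
    genericSextic.map (MvPolynomial.eval (Sum.elim w u)) = sextic I w u := by
  rw [genericSextic, map_sextic, eval_comp_genericWeight, MvPolynomial.eval_C]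
  congr 1
  ext j; simp

lemma map_det₁_genericWeight (w u : Fin 4 → ℂ) :
    (det₁ genericWeight).map (MvPolynomial.eval (Sum.elim w u)) = det₁ w := by
  rw [map_det₁, eval_comp_genericWeight]

lemma map_det₂_genericWeight (w u : Fin 4 → ℂ) :
    (det₂ genericWeight).map (MvPolynomial.eval (Sum.elim w u)) = det₂ w := by
  rw [map_det₂, eval_comp_genericWeight]

lemma eval_coeff_genericSextic (w u : Fin 4 → ℂ) :
    MvPolynomial.eval (Sum.elim w u) (genericSextic.coeff 6) = (sextic I w u).coeff 6 := by
  rw [← map_genericSextic, coeff_map]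

lemma coeff_genericSextic_ne_zero : genericSextic.coeff 6 ≠ 0 := by
  intro h
  have hlead := eval_coeff_genericSextic specialWeight specialData
  rw [h, map_zero, ← natDegree_sextic_special, eq_comm, coeff_natDegree,
    leadingCoeff_eq_zero] at hlead
  simpa [hlead] using natDegree_sextic_special

lemma exists_generic_isCoprime_sextic (Q : (MvPolynomial (Fin 4 ⊕ Fin 4) ℂ)[X]) (n : ℕ)
    (hQ : Q.natDegree ≤ n)
    (hQp : (Q.map (MvPolynomial.eval (Sum.elim specialWeight specialData))).natDegree = n)
    (hcop : IsCoprime (sextic I specialWeight specialData)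
      (Q.map (MvPolynomial.eval (Sum.elim specialWeight specialData)))) :
    ∃ G : MvPolynomial (Fin 4 ⊕ Fin 4) ℂ, G ≠ 0 ∧
      ∀ w u : Fin 4 → ℂ, MvPolynomial.eval (Sum.elim w u) G ≠ 0 →
        IsCoprime (sextic I w u) (Q.map (MvPolynomial.eval (Sum.elim w u))) := by
  obtain ⟨G, hG, h⟩ := exists_generic_isCoprime genericSextic Q 6 n
    (natDegree_sextic_le _ _ _) hQ (by norm_num) (Sum.elim specialWeight specialData)
    (by rw [map_genericSextic, natDegree_sextic_special]) hQp (by rwa [map_genericSextic])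
  exact ⟨G, hG, fun w u hwu => map_genericSextic w u ▸ h _ hwu⟩

end Generic

end QuadricED

open QuadricED

/-- The generic Euclidean distance degree of the quadric
`F = (x₁ - i x₀)² + 2(x₃ - i x₂)² + x₀² + x₁² + x₂² + x₃²` is `6`: there is a
nonzero polynomial `G` in the weights `w` and data `u` such that whenever
`G(w, u) ≠ 0`, there are exactly `6` nonzero points `x` with `F(x) = 0` at which
`(wᵢ(xᵢ - uᵢ))ᵢ` is a complex scalar multiple of the gradient `∇F(x)`. -/
theorem stmt_12 :
    ∃ G : MvPolynomial (Fin 4 ⊕ Fin 4) ℂ, G ≠ 0 ∧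
      ∀ w u : Fin 4 → ℂ, MvPolynomial.eval (Sum.elim w u) G ≠ 0 →
        Set.ncard {x : Fin 4 → ℂ | x ≠ 0 ∧
          (x 1 - I * x 0) ^ 2 + 2 * (x 3 - I * x 2) ^ 2 +
            ((x 0) ^ 2 + (x 1) ^ 2 + (x 2) ^ 2 + (x 3) ^ 2) = 0 ∧
          ∃ l : ℂ, (fun i => w i * (x i - u i)) =
            l • ((2 * (x 1 - I * x 0)) • ![-I, 1, 0, 0] +
              (4 * (x 3 - I * x 2)) • ![0, 0, -I, 1] + (2 : ℂ) • x)} = 6 := by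
  obtain ⟨G₀, hG₀, h₀⟩ := exists_generic_isCoprime_sextic genericSextic.derivative 5
    ((Polynomial.natDegree_derivative_le _).trans
      (Nat.sub_le_sub_right (natDegree_sextic_le _ _ _) 1))
    (by rw [← Polynomial.derivative_map, map_genericSextic, natDegree_derivative_sextic_special])
    (by rw [← Polynomial.derivative_map, map_genericSextic]; exact sextic_special_separable)
  obtain ⟨G₁, hG₁, h₁⟩ := exists_generic_isCoprime_sextic (det₁ genericWeight) 2
    (natDegree_det₁_le _) (by rw [map_det₁_genericWeight, natDegree_det₁_special])
    (by rw [map_det₁_genericWeight]; exact sextic_special_isCoprime_det₁)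
  obtain ⟨G₂, hG₂, h₂⟩ := exists_generic_isCoprime_sextic (det₂ genericWeight) 2
    (natDegree_det₂_le _) (by rw [map_det₂_genericWeight, natDegree_det₂_special])
    (by rw [map_det₂_genericWeight]; exact sextic_special_isCoprime_det₂)
  refine ⟨MvPolynomial.X (Sum.inl 0) * MvPolynomial.X (Sum.inr 0) * genericSextic.coeff 6 *
    (G₀ * G₁ * G₂), by simp [hG₀, hG₁, hG₂, coeff_genericSextic_ne_zero], fun w u hG => ?_⟩
  simp only [map_mul, MvPolynomial.eval_X, Sum.elim_inl, Sum.elim_inr, mul_ne_zero_iff,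
    eval_coeff_genericSextic] at hG
  obtain ⟨⟨⟨hw, hu⟩, hlead⟩, ⟨hg₀, hg₁⟩, hg₂⟩ := hG
  have c₀ := h₀ w u hg₀
  have c₁ := h₁ w u hg₁
  have c₂ := h₂ w u hg₂
  rw [← Polynomial.derivative_map, map_genericSextic] at c₀
  rw [map_det₁_genericWeight] at c₁
  rw [map_det₂_genericWeight] at c₂
  exact ncard_criticalSet w u hw hu hlead c₀ c₁ c₂
end
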